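/- (McAllester–Langford PAC-Bayes bound) Let l be the zero-one loss (so l takes values in {0,1}). For any δ > 0, any data distribution 𝒟 on the sample space X × Y, and any prior probability distribution p on the measurable parameter space of Θ, with probability at least 1 − δ over the choice of an i.i.d. training set D ∼ 𝒟^m of size m, simultaneously for all probability distributions q on the parameter space: kl(L̂[q] ‖ L[q]) ≤ (KL(q ‖ p) + log(m/δ)) / (m − 1), where kl(a‖b) = a·log(a/b) + (1−a)·log((1−a)/(1−b)) is the KL divergence between Bernoulli distributions with parameters a and b. -/

import Mathlib

open MeasureTheory ProbabilityTheory
open scoped ENNReal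

/-- KL divergence between two Bernoulli distributions with parameters `a` and `b`. -/
noncomputable def bernoulliKL (a b : ℝ) : ℝ :=
  a * Real.log (a / b) + (1 - a) * Real.log ((1 - a) / (1 - b))

open Classical in
/-- Kullback–Leibler divergence between two measures, `∞` if `q` is not absolutely
continuous with respect to `p` or the log-likelihood ratio is not integrable. -/
noncomputable def klDiv' {Ω : Type*} [MeasurableSpace Ω] (q p : Measure Ω) : ℝ≥0∞ :=
  if q ≪ p ∧ Integrable (llr q p) q then ENNReal.ofReal (∫ ω, llr q p ω ∂q) else ⊤


lemma pb_dv {Θ : Type*} [MeasurableSpace Θ] (p q : Measure Θ) [IsProbabilityMeasure p]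
    [IsProbabilityMeasure q] (hac : q ≪ p) (hllr : Integrable (llr q p) q)
    (h : Θ → ℝ) (hh : Integrable h q) (F : Θ → ℝ≥0∞) (hF : Measurable F) (Z : ℝ) (hZ : 0 < Z)
    (hFZ : ∫⁻ θ, F θ ∂p ≤ ENNReal.ofReal Z)
    (hle : ∀ᵐ θ ∂q, ENNReal.ofReal (Real.exp (h θ)) ≤ F θ) :
    ∫ θ, h θ ∂q ≤ ∫ θ, llr q p θ ∂q + Real.log Z := by
  have hi : Integrable (fun θ => h θ - llr q p θ) q := hh.sub hllr
  have h1 : ∫⁻ θ, ENNReal.ofReal (Real.exp (h θ - llr q p θ)) ∂q ≤ ENNReal.ofReal Z := by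
    calc ∫⁻ θ, ENNReal.ofReal (Real.exp (h θ - llr q p θ)) ∂q
        ≤ ∫⁻ θ, F θ * (q.rnDeriv p θ)⁻¹ ∂q := by
          apply lintegral_mono_ae
          filter_upwards [hle, exp_llr_of_ac q p hac, Measure.rnDeriv_pos hac,
            hac.ae_le (Measure.rnDeriv_lt_top q p)] with θ h1 h2 h3 h4
          rw [Real.exp_sub, h2, div_eq_mul_inv, ENNReal.ofReal_mul (Real.exp_nonneg _),
            ENNReal.ofReal_inv_of_pos (ENNReal.toReal_pos h3.ne' h4.ne),
            ENNReal.ofReal_toReal h4.ne]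
          gcongr
      _ = ∫⁻ θ, q.rnDeriv p θ * (F θ * (q.rnDeriv p θ)⁻¹) ∂p := by
          rw [lintegral_rnDeriv_mul hac]
          exact (hF.mul (Measure.measurable_rnDeriv q p).inv).aemeasurable
      _ ≤ ∫⁻ θ, F θ ∂p := by
          apply lintegral_mono
          intro θ
          dsimp only
          calc q.rnDeriv p θ * (F θ * (q.rnDeriv p θ)⁻¹)
              = F θ * (q.rnDeriv p θ * (q.rnDeriv p θ)⁻¹) := by ring
            _ ≤ F θ * 1 := by gcongr; exact ENNReal.mul_inv_le_one _
            _ = F θ := mul_one _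
      _ ≤ _ := hFZ
  have hae : AEStronglyMeasurable (fun θ => Real.exp (h θ - llr q p θ)) q :=
    Real.continuous_exp.comp_aestronglyMeasurable hi.1
  have hei : Integrable (fun θ => Real.exp (h θ - llr q p θ)) q := by
    refine ⟨hae, ?_⟩
    rw [hasFiniteIntegral_iff_ofReal (Filter.Eventually.of_forall fun _ => Real.exp_nonneg _)]
    exact h1.trans_lt ENNReal.ofReal_lt_top
  have h2 : ∫ θ, Real.exp (h θ - llr q p θ) ∂q ≤ Z := by
    rw [← ofReal_integral_eq_lintegral_ofReal hei
      (Filter.Eventually.of_forall fun _ => Real.exp_nonneg _)] at h1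
    exact (ENNReal.ofReal_le_ofReal_iff hZ.le).1 h1
  have h3 : ∫ θ, (h θ - llr q p θ) ∂q ≤ ∫ θ, (Real.exp (h θ - llr q p θ) / Z + (Real.log Z - 1)) ∂q := by
    apply integral_mono hi ((hei.div_const Z).add (integrable_const _))
    intro θ
    have := Real.add_one_le_exp (h θ - llr q p θ - Real.log Z)
    rw [Real.exp_sub _ (Real.log Z), Real.exp_log hZ] at this
    simp only [Pi.add_apply]
    linarith
  rw [integral_sub hh hllr, integral_add (hei.div_const Z) (integrable_const _),
    integral_div, integral_const] at h3
  simp only [probReal_univ, smul_eq_mul, one_mul] at h3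
  have : (∫ θ, Real.exp (h θ - llr q p θ) ∂q) / Z ≤ 1 := (div_le_one hZ).2 h2
  linarith

lemma pb_pow (k : ℕ) (M c r : ℝ) (hM : 0 < M) (hc : 0 ≤ c) (hr : 0 ≤ r) (hk : c = 0 → k = 0) :
    ENNReal.ofReal (Real.exp (k * Real.log c + k - M * r * c)) ≤
      (ENNReal.ofReal (k / M) / ENNReal.ofReal r) ^ k := by
  rcases Nat.eq_zero_or_pos k with rfl | hkpos
  · simp
    positivity
  have hk' : (0:ℝ) < k := by exact_mod_cast hkpos
  have hcpos : 0 < c := lt_of_le_of_ne hc (fun h => hkpos.ne' (hk h.symm))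
  rcases hr.eq_or_lt with rfl | hrpos
  · rw [ENNReal.ofReal_zero, ENNReal.div_zero, ENNReal.top_pow hkpos.ne']
    · exact le_top
    · simpa using by positivity
  · rw [← ENNReal.ofReal_div_of_pos hrpos, ← ENNReal.ofReal_pow (by positivity)]
    apply ENNReal.ofReal_le_ofReal
    have hpos : 0 < k / M / r := by positivity
    rw [← Real.exp_log (pow_pos hpos k), Real.log_pow]
    apply Real.exp_le_exp.2
    have h1 := Real.log_le_sub_one_of_pos (show 0 < c / (k / M / r) by positivity)
    rw [Real.log_div hcpos.ne' hpos.ne'] at h1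
    have h2 := mul_le_mul_of_nonneg_left h1 hk'.le
    have h3 : k * (c / (k / M / r)) = M * r * c := by field_simp
    nlinarith

lemma pb_bern_edge (a b : ℝ) (ha0 : 0 ≤ a) (ha1 : a ≤ 1) (hb : b = 0 ∨ b = 1) :
    bernoulliKL a b ≤ 0 := by
  unfold bernoulliKL
  rcases hb with rfl | rfl
  · simp
    exact mul_nonpos_of_nonneg_of_nonpos (by linarith) (Real.log_nonpos (by linarith) (by linarith))
  · simp
    exact mul_nonpos_of_nonneg_of_nonpos (by linarith) (Real.log_nonpos (by linarith) (by linarith))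

/-- single-sample weight -/
noncomputable def pbW (M : ℝ) (j : ℝ) (r ℓ : ℝ) : ℝ≥0∞ :=
  ENNReal.ofReal ℓ * (ENNReal.ofReal (j / M) / ENNReal.ofReal r)
    + ENNReal.ofReal (1 - ℓ) * (ENNReal.ofReal ((M - j) / M) / ENNReal.ofReal (1 - r))

lemma pbW_lintegral {Z : Type*} [MeasurableSpace Z] (𝒟 : Measure Z) [IsProbabilityMeasure 𝒟]
    (ℓ : Z → ℝ) (hℓ : Measurable ℓ) (h01 : ∀ z, ℓ z = 0 ∨ ℓ z = 1) (M j : ℝ) (hM : 0 < M)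
    (hj : 0 ≤ j) (hjM : j ≤ M) :
    ∫⁻ z, pbW M j (∫ z, ℓ z ∂𝒟) (ℓ z) ∂𝒟 ≤ 1 := by
  have hint : Integrable ℓ 𝒟 := by
    refine Integrable.of_bound hℓ.aestronglyMeasurable 1 (Filter.Eventually.of_forall fun z => ?_)
    rcases h01 z with h | h <;> simp [h]
  have h1 : ∫⁻ z, ENNReal.ofReal (ℓ z) ∂𝒟 = ENNReal.ofReal (∫ z, ℓ z ∂𝒟) := by
    rw [ofReal_integral_eq_lintegral_ofReal hint]
    exact Filter.Eventually.of_forall fun z => by rcases h01 z with h | h <;> simp [h]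
  have h2 : ∫⁻ z, ENNReal.ofReal (1 - ℓ z) ∂𝒟 = ENNReal.ofReal (1 - ∫ z, ℓ z ∂𝒟) := by
    have hint' : Integrable (fun z => 1 - ℓ z) 𝒟 := (integrable_const 1).sub hint
    rw [← ofReal_integral_eq_lintegral_ofReal hint', integral_sub (integrable_const 1) hint]
    · simp
    exact Filter.Eventually.of_forall fun z => by rcases h01 z with h | h <;> simp [h]
  unfold pbW
  rw [lintegral_add_left (by fun_prop), lintegral_mul_const _ (by fun_prop),
    lintegral_mul_const _ (by fun_prop), h1, h2]
  calc _ ≤ ENNReal.ofReal (j / M) + ENNReal.ofReal ((M - j) / M) := by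
        gcongr <;> exact ENNReal.mul_div_le
    _ = 1 := by
        rw [← ENNReal.ofReal_add (by positivity) (div_nonneg (by linarith) hM.le), ← add_div]
        simp [hM.ne']

lemma pb_prod_lintegral {Z : Type*} [MeasurableSpace Z] (𝒟 : Measure Z) [IsProbabilityMeasure 𝒟]
    (m : ℕ) (g : Z → ℝ≥0∞) (hg : Measurable g) :
    ∫⁻ D, ∏ i : Fin m, g (D i) ∂(Measure.pi fun _ : Fin m => 𝒟) = (∫⁻ z, g z ∂𝒟) ^ m := by
  have hind : iIndepFun (fun (i : Fin m) (D : Fin m → Z) => g (D i))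
      (Measure.pi fun _ : Fin m => 𝒟) :=
    iIndepFun_pi (μ := fun _ : Fin m => 𝒟) (X := fun _ => g) (fun _ => hg.aemeasurable)
  rw [lintegral_prod_eq_prod_lintegral_of_indepFun Finset.univ _ hind (fun i => by fun_prop)]
  have : ∀ i : Fin m, ∫⁻ D, g (D i) ∂(Measure.pi fun _ : Fin m => 𝒟) = ∫⁻ z, g z ∂𝒟 := fun i =>
    (measurePreserving_eval (fun _ : Fin m => 𝒟) i).lintegral_comp hg
  simp [this]

lemma pb_core {Z Θ : Type*} [MeasurableSpace Z] [MeasurableSpace Θ]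
    (p q : Measure Θ) [IsProbabilityMeasure p] [IsProbabilityMeasure q]
    (m : ℕ) (hm : 1 < m)
    (ℓ : Θ → Z → ℝ) (h01 : ∀ θ z, ℓ θ z = 0 ∨ ℓ θ z = 1)
    (hℓ : Measurable (Function.uncurry ℓ))
    (R : Θ → ℝ) (hR : Measurable R) (hR0 : ∀ θ, 0 ≤ R θ) (hR1 : ∀ θ, R θ ≤ 1)
    (D : Fin m → Z) (C : ℝ) (hC : 1 ≤ C)
    (hD : ∫⁻ θ, ∑ j ∈ Finset.range (m + 1), ∏ i : Fin m, pbW m j (R θ) (ℓ θ (D i)) ∂p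
      ≤ ENNReal.ofReal C)
    (hac : q ≪ p) (hllr : Integrable (llr q p) q) :
    m * bernoulliKL (∫ θ, (∑ i : Fin m, ℓ θ (D i)) / m ∂q) (∫ θ, R θ ∂q) ≤
      max 0 (∫ θ, llr q p θ ∂q) + Real.log C := by
  have hm0 : (0:ℝ) < m := by exact_mod_cast (by omega : 0 < m)
  have hℓi : ∀ z, Measurable (fun θ => ℓ θ z) := fun z =>
    hℓ.comp (by fun_prop : Measurable fun θ : Θ => (θ, z))
  set A : Θ → ℝ := fun θ => (∑ i : Fin m, ℓ θ (D i)) / m with hA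
  have hAm : Measurable A := by
    apply Measurable.div_const
    exact Finset.measurable_sum _ fun i _ => hℓi _
  have hcard : ∀ θ, ∃ k : ℕ, k ≤ m ∧ A θ = k / m ∧ ∀ j r, ∏ i : Fin m, pbW m j r (ℓ θ (D i)) =
      (ENNReal.ofReal (j / m) / ENNReal.ofReal r) ^ k *
      (ENNReal.ofReal ((m - j) / m) / ENNReal.ofReal (1 - r)) ^ (m - k) := by
    intro θ
    classical
    refine ⟨(Finset.univ.filter fun i => ℓ θ (D i) = 1).card, ?_, ?_, ?_⟩
    · simpa using Finset.card_filter_le Finset.univ (fun i : Fin m => ℓ θ (D i) = 1)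
    · have : ∀ i, ℓ θ (D i) = if ℓ θ (D i) = 1 then 1 else 0 := by
        intro i; rcases h01 θ (D i) with h | h <;> simp [h]
      simp only [hA]
      rw [Finset.sum_congr rfl (fun i _ => this i)]
      simp
    · intro j r
      have : ∀ i, pbW m j r (ℓ θ (D i)) = if ℓ θ (D i) = 1 then
          (ENNReal.ofReal (j / m) / ENNReal.ofReal r) else
          (ENNReal.ofReal ((m - j) / m) / ENNReal.ofReal (1 - r)) := by
        intro i; rcases h01 θ (D i) with h | h <;> simp [h, pbW]
      rw [Finset.prod_congr rfl (fun i _ => this i), Finset.prod_ite]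
      simp only [Finset.prod_const]
      congr 2
      have := Finset.card_filter_add_card_filter_not (s := Finset.univ) (fun i : Fin m => ℓ θ (D i) = 1)
      simp only [Finset.card_univ, Fintype.card_fin] at this
      omega
  have hA0 : ∀ θ, 0 ≤ A θ := fun θ => by
    obtain ⟨k, hk, h, -⟩ := hcard θ
    rw [h]; positivity
  have hA1 : ∀ θ, A θ ≤ 1 := fun θ => by
    obtain ⟨k, hk, h, -⟩ := hcard θ
    rw [h, div_le_one hm0]; exact_mod_cast hk
  have hAi : Integrable A q := Integrable.of_bound hAm.aestronglyMeasurable 1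
    (Filter.Eventually.of_forall fun θ => by
      rw [Real.norm_eq_abs, abs_of_nonneg (hA0 θ)]; exact hA1 θ)
  have hRi : Integrable R q := Integrable.of_bound hR.aestronglyMeasurable 1
    (Filter.Eventually.of_forall fun θ => by
      rw [Real.norm_eq_abs, abs_of_nonneg (hR0 θ)]; exact hR1 θ)
  have hAi' : Integrable (fun θ => 1 - A θ) q := (integrable_const 1).sub hAi
  have hRi' : Integrable (fun θ => 1 - R θ) q := (integrable_const 1).sub hRi
  have e1 : ∫ θ, (1 - A θ) ∂q = 1 - ∫ θ, A θ ∂q := by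
    rw [integral_sub (integrable_const 1) hAi]; simp
  have e2 : ∫ θ, (1 - R θ) ∂q = 1 - ∫ θ, R θ ∂q := by
    rw [integral_sub (integrable_const 1) hRi]; simp
  have ha0 : 0 ≤ ∫ θ, A θ ∂q := integral_nonneg hA0
  have ha1 : 0 ≤ ∫ θ, (1 - A θ) ∂q := integral_nonneg fun θ => sub_nonneg.2 (hA1 θ)
  have hb0 : 0 ≤ ∫ θ, R θ ∂q := integral_nonneg hR0
  have hb1 : 0 ≤ ∫ θ, (1 - R θ) ∂q := integral_nonneg fun θ => sub_nonneg.2 (hR1 θ)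
  have hAz : ∫ θ, A θ ∂q = 0 → ∀ᵐ θ ∂q, A θ = 0 := fun h =>
    (integral_eq_zero_iff_of_nonneg hA0 hAi).1 h
  have hAz' : ∫ θ, (1 - A θ) ∂q = 0 → ∀ᵐ θ ∂q, 1 - A θ = 0 := fun h =>
    (integral_eq_zero_iff_of_nonneg (fun θ => sub_nonneg.2 (hA1 θ)) hAi').1 h
  rw [e1] at ha1 hAz'
  rw [e2] at hb1
  generalize ha : ∫ θ, A θ ∂q = a at *
  generalize hb : ∫ θ, R θ ∂q = b at *
  have hlogC := Real.log_nonneg hC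
  by_cases hbe : b = 0 ∨ b = 1
  · have := pb_bern_edge a b ha0 (by linarith) hbe
    have h2 := le_max_left 0 (∫ θ, llr q p θ ∂q)
    nlinarith
  push Not at hbe
  have hbpos : 0 < b := lt_of_le_of_ne hb0 hbe.1.symm
  have hbpos' : 0 < 1 - b := lt_of_le_of_ne hb1 (fun h => hbe.2 (by linarith))
  set c := a / b with hc
  set c' := (1 - a) / (1 - b) with hc'
  let T : Θ → ℝ := fun θ => ((m * Real.log c + m) * A θ - m * c * R θ) +
    ((m * Real.log c' + m) * (1 - A θ) - m * c' * (1 - R θ))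
  have hT1 : Integrable (fun θ => (m * Real.log c + m) * A θ - m * c * R θ) q :=
    (hAi.const_mul _).sub (hRi.const_mul _)
  have hT2 : Integrable (fun θ => (m * Real.log c' + m) * (1 - A θ) - m * c' * (1 - R θ)) q :=
    (hAi'.const_mul _).sub (hRi'.const_mul _)
  have hTi : ∫ θ, T θ ∂q = m * bernoulliKL a b := by
    simp only [T]
    rw [integral_add hT1 hT2, integral_sub (hAi.const_mul _) (hRi.const_mul _),
      integral_sub (hAi'.const_mul _) (hRi'.const_mul _)]
    simp only [integral_const_mul]
    rw [e1, e2, ha, hb]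
    unfold bernoulliKL
    rw [← hc, ← hc']
    have : c * b = a := by rw [hc]; field_simp
    have : c' * (1 - b) = 1 - a := by rw [hc']; field_simp
    linear_combination (-(m:ℝ)) * ‹c * b = a› - m * this
  have hF : Measurable fun θ => ∑ j ∈ Finset.range (m + 1), ∏ i : Fin m, pbW m j (R θ) (ℓ θ (D i)) := by
    refine Finset.measurable_sum _ fun j _ => Finset.measurable_prod _ fun i _ => ?_
    have := hℓi (D i)
    unfold pbW
    fun_prop
  have key := pb_dv p q hac hllr T (hT1.add hT2) _ hF C (by linarith) hD ?_
  · rw [hTi] at key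
    have h2 := le_max_right 0 (∫ θ, llr q p θ ∂q)
    linarith
  have z1 : ∀ᵐ θ ∂q, c = 0 → A θ = 0 := by
    by_cases h : c = 0
    · have : a = 0 := by
        rw [hc, div_eq_zero_iff] at h; exact h.resolve_right hbpos.ne'
      filter_upwards [hAz this] with θ h _ using h
    · exact Filter.Eventually.of_forall fun _ h' => absurd h' h
  have z2 : ∀ᵐ θ ∂q, c' = 0 → 1 - A θ = 0 := by
    by_cases h : c' = 0
    · have : 1 - a = 0 := by
        rw [hc', div_eq_zero_iff] at h; exact h.resolve_right hbpos'.ne'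
      filter_upwards [hAz' this] with θ h _ using h
    · exact Filter.Eventually.of_forall fun _ h' => absurd h' h
  filter_upwards [z1, z2] with θ y1 y2
  obtain ⟨k, hk, hAk, hprod⟩ := hcard θ
  refine le_trans ?_ (Finset.single_le_sum (f := fun j : ℕ => ∏ i : Fin m, pbW m j (R θ) (ℓ θ (D i)))
    (fun _ _ => zero_le) (Finset.mem_range.2 (Nat.lt_succ_of_le hk)))
  rw [hprod]
  have w1 := pb_pow k m c (R θ) hm0 (div_nonneg ha0 hb0) (hR0 θ) (fun h => by
    have := y1 h
    rw [hAk, div_eq_zero_iff] at this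
    exact_mod_cast this.resolve_right hm0.ne')
  have hmk : ((m - k : ℕ) : ℝ) = m - k := Nat.cast_sub hk
  have w2 := pb_pow (m - k) m c' (1 - R θ) hm0 (div_nonneg ha1 hb1) (sub_nonneg.2 (hR1 θ)) (fun h => by
    have := y2 h
    rw [hAk] at this
    have h3 : (k:ℝ) = m := by field_simp at this; linarith
    have : k = m := by exact_mod_cast h3
    omega)
  rw [hmk] at w2
  refine le_trans (le_of_eq ?_) (mul_le_mul' w1 w2)
  rw [← ENNReal.ofReal_mul (Real.exp_nonneg _), ← Real.exp_add]
  congr 2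
  simp only [T, hAk]
  field_simp

/-- McAllester–Langford PAC-Bayes bound for the zero-one loss. -/
theorem mcallester_pac_bayes
    {X Y Θ : Type*} [MeasurableSpace X] [MeasurableSpace Y] [MeasurableSpace Θ]
    (𝒟 : Measure (X × Y)) [IsProbabilityMeasure 𝒟]
    (p : Measure Θ) [IsProbabilityMeasure p]
    (f : Θ → X → Y) (l : Y → Y → ℝ)
    (hl01 : ∀ y y', l y y' = 0 ∨ l y y' = 1)
    (hmeas : Measurable (fun z : Θ × (X × Y) => l z.2.2 (f z.1 z.2.1)))
    (m : ℕ) (hm : 1 < m) (δ : ℝ) (hδ : 0 < δ) :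
    ENNReal.ofReal (1 - δ) ≤
      (Measure.pi fun _ : Fin m => 𝒟)
        {D : Fin m → X × Y | ∀ q : Measure Θ, IsProbabilityMeasure q →
          klDiv' q p = ⊤ ∨
          bernoulliKL
              (∫ θ, (∑ i : Fin m, l (D i).2 (f θ (D i).1)) / m ∂q)
              (∫ θ, ∫ xy, l xy.2 (f θ xy.1) ∂𝒟 ∂q)
            ≤ ((klDiv' q p).toReal + Real.log (m / δ)) / (m - 1)} := by
  rcases le_or_gt 1 δ with h1δ | hδ1
  · rw [ENNReal.ofReal_of_nonpos (by linarith)]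
    exact zero_le
  have hm1 : (1:ℝ) < m := by exact_mod_cast hm
  have hm0 : (0:ℝ) < m := by linarith
  let ℓ : Θ → X × Y → ℝ := fun θ xy => l xy.2 (f θ xy.1)
  have hℓ : Measurable (Function.uncurry ℓ) := hmeas
  have h01 : ∀ θ z, ℓ θ z = 0 ∨ ℓ θ z = 1 := fun θ z => hl01 _ _
  let R : Θ → ℝ := fun θ => ∫ xy, ℓ θ xy ∂𝒟
  have hR : Measurable R := (hℓ.stronglyMeasurable.integral_prod_right).measurable
  have hint : ∀ θ, Integrable (ℓ θ) 𝒟 := fun θ => by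
    refine Integrable.of_bound (hℓ.comp (by fun_prop : Measurable fun z => (θ, z))).aestronglyMeasurable 1
      (Filter.Eventually.of_forall fun z => ?_)
    rcases h01 θ z with h | h <;> simp [Function.uncurry, h]
  have hR0 : ∀ θ, 0 ≤ R θ := fun θ => integral_nonneg fun z => by
    rcases h01 θ z with h | h <;> simp [h]
  have hR1 : ∀ θ, R θ ≤ 1 := fun θ => by
    have := integral_mono (hint θ) (integrable_const (μ := 𝒟) (1:ℝ)) fun z => by
      rcases h01 θ z with h | h <;> simp [h]
    simpa using this
  let μ := Measure.pi fun _ : Fin m => 𝒟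
  let F : Θ → (Fin m → X × Y) → ℝ≥0∞ := fun θ D =>
    ∑ j ∈ Finset.range (m + 1), ∏ i : Fin m, pbW m j (R θ) (ℓ θ (D i))
  have hFm : Measurable (Function.uncurry F) := by
    refine Finset.measurable_sum _ fun j _ => Finset.measurable_prod _ fun i _ => ?_
    have h1 : Measurable fun x : Θ × (Fin m → X × Y) => ℓ x.1 (x.2 i) :=
      hℓ.comp (by fun_prop : Measurable fun x : Θ × (Fin m → X × Y) => (x.1, x.2 i))
    have h2 : Measurable fun x : Θ × (Fin m → X × Y) => R x.1 := hR.comp measurable_fst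
    unfold pbW
    fun_prop
  let G : (Fin m → X × Y) → ℝ≥0∞ := fun D => ∫⁻ θ, F θ D ∂p
  have hGm : Measurable G := hFm.lintegral_prod_left'
  have hG : ∫⁻ D, G D ∂μ ≤ ENNReal.ofReal (m + 1) := by
    simp only [G]
    rw [lintegral_lintegral_swap (f := fun D θ => F θ D) (hFm.comp measurable_swap).aemeasurable]
    calc ∫⁻ θ, ∫⁻ D, F θ D ∂μ ∂p ≤ ∫⁻ θ, ENNReal.ofReal (m + 1) ∂p := by
          apply lintegral_mono
          intro θ
          have hw : ∀ j : ℕ, Measurable fun z => pbW m j (R θ) (ℓ θ z) := fun j => by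
            have : Measurable (ℓ θ) := hℓ.comp (by fun_prop : Measurable fun z => (θ, z))
            unfold pbW
            fun_prop
          simp only [F]
          have hw' : ∀ j ∈ Finset.range (m + 1), Measurable fun D : Fin m → X × Y =>
              ∏ i : Fin m, pbW m j (R θ) (ℓ θ (D i)) := fun j _ =>
            Finset.measurable_prod _ fun i _ => (hw j).comp (measurable_pi_apply i)
          rw [lintegral_finsetSum _ hw']
          calc _ ≤ ∑ j ∈ Finset.range (m + 1), (1 : ℝ≥0∞) := by
                apply Finset.sum_le_sum
                intro j hj
                rw [pb_prod_lintegral 𝒟 m _ (hw j)]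
                apply pow_le_one₀ zero_le
                apply pbW_lintegral 𝒟 (ℓ θ) (hℓ.comp (by fun_prop : Measurable fun z => (θ, z)))
                  (h01 θ) m j hm0 (by positivity)
                exact_mod_cast Nat.lt_succ_iff.1 (Finset.mem_range.1 hj)
            _ = ENNReal.ofReal (m + 1) := by
                rw [show (m:ℝ) + 1 = ((m + 1 : ℕ) : ℝ) by push_cast; ring, ENNReal.ofReal_natCast]
                simp
      _ = _ := by simp
  let C : ℝ := (m + 1) / δ
  have hCpos : 0 < C := by positivity
  have hC1 : 1 ≤ C := by
    rw [one_le_div hδ]; linarith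
  have hmark : μ {D | ENNReal.ofReal C ≤ G D} ≤ ENNReal.ofReal δ := by
    refine (meas_ge_le_lintegral_div hGm.aemeasurable (by simpa using hCpos) ENNReal.ofReal_ne_top).trans ?_
    refine (ENNReal.div_le_div_right hG _).trans ?_
    rw [← ENNReal.ofReal_div_of_pos hCpos]
    apply ENNReal.ofReal_le_ofReal
    apply le_of_eq
    simp only [C]
    field_simp
  have hgood : ENNReal.ofReal (1 - δ) ≤ μ {D | ENNReal.ofReal C ≤ G D}ᶜ := by
    rw [prob_compl_eq_one_sub (measurableSet_le measurable_const hGm),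
      ENNReal.ofReal_sub _ hδ.le, ENNReal.ofReal_one]
    exact tsub_le_tsub_left hmark 1
  refine hgood.trans (measure_mono ?_)
  intro D hD q hq
  have hD' : G D ≤ ENNReal.ofReal C := by
    have h : ¬ ENNReal.ofReal C ≤ G D := hD
    exact (not_le.1 h).le
  by_cases hkl : q ≪ p ∧ Integrable (llr q p) q
  · right
    have core := pb_core p q m hm ℓ h01 hℓ R hR hR0 hR1 D C hC1 hD' hkl.1 hkl.2
    have hto : (klDiv' q p).toReal = max 0 (∫ θ, llr q p θ ∂q) := by
      rw [klDiv', if_pos hkl, ENNReal.toReal_ofReal', max_comm]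
    rw [hto]
    change bernoulliKL (∫ θ, (∑ i : Fin m, ℓ θ (D i)) / m ∂q) (∫ θ, R θ ∂q) ≤ _
    generalize bernoulliKL (∫ θ, (∑ i : Fin m, ℓ θ (D i)) / m ∂q) (∫ θ, R θ ∂q) = B at *
    have hK : 0 ≤ max 0 (∫ θ, llr q p θ ∂q) := le_max_left _ _
    generalize max 0 (∫ θ, llr q p θ ∂q) = K at *
    rw [le_div_iff₀ (by linarith), Real.log_div hm0.ne' hδ.ne']
    simp only [C] at core
    rw [Real.log_div (by positivity) hδ.ne'] at core
    have hlδ : Real.log δ ≤ 0 := Real.log_nonpos hδ.le hδ1.le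
    -- (m-1) log (m+1) ≤ m log m
    have g1 : Real.log (m + 1) ≤ Real.log m + 1 / m := by
      have := Real.log_le_sub_one_of_pos (show (0:ℝ) < (m + 1) / m by positivity)
      rw [Real.log_div (by positivity) hm0.ne'] at this
      have e : ((m:ℝ) + 1) / m - 1 = 1 / m := by field_simp; ring
      linarith
    have g2 : 1 - 1 / (m:ℝ) ≤ Real.log m := by
      have := Real.one_sub_inv_le_log_of_pos hm0
      simpa using this
    have g3 : (m - 1) * Real.log (m + 1) ≤ m * Real.log m := by
      have := mul_le_mul_of_nonneg_left g1 (by linarith : (0:ℝ) ≤ m - 1)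
      have e : ((m:ℝ) - 1) * (1 / m) = 1 - 1 / m := by field_simp
      nlinarith
    have g4 := mul_le_mul_of_nonneg_left core (by linarith : (0:ℝ) ≤ m - 1)
    have g5 : m * (B * (m - 1)) ≤ m * (K + (Real.log m - Real.log δ)) := by
      nlinarith
    exact le_of_mul_le_mul_left g5 hm0
  · left
    rw [klDiv', if_neg hkl]
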